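/- Let U and V be N×N real positive semidefinite matrices with eigenvalues λ_1 ≥ ... ≥ λ_N and ν_1 ≥ ... ≥ ν_N respectively, and let C ∈ ℝ^{n×N} satisfy C Cᵀ = I_n. Then tr(UV) − tr((C U Cᵀ)(C V Cᵀ)) ≤ ν_{N−n+1} Σ_{i=1}^{n}(λ_i − λ^{(c)}_i) + C_{U,V,n}, where λ^{(c)}_1 ≥ ... ≥ λ^{(c)}_n are the eigenvalues of C U Cᵀ and C_{U,V,n} = Σ_{i=1}^{n} λ_i(ν_i − ν_{N−i+1}) + Σ_{i=n+1}^{N} λ_i ν_i ≥ 0. -/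

import Mathlib

open Matrix

/-- Abel summation: nonnegative prefix sums pair nonnegatively with an antitone nonnegative
weight. -/
theorem sum_mul_nonneg_of_antitone_of_prefix {n : ℕ} (a x : Fin n → ℝ) (ha : Antitone a)
    (ha0 : ∀ i, 0 ≤ a i) (hx : ∀ k ≤ n, 0 ≤ ∑ i, if i.val < k then x i else 0) :
    0 ≤ ∑ i, a i * x i := by
  induction n with
  | zero => simp
  | succ n ih =>
    have hprefix := ih (fun i => a i.castSucc - a (Fin.last n)) (fun i => x i.castSucc)
      (fun i j hij => sub_le_sub_right (ha (Fin.castSucc_le_castSucc_iff.2 hij)) _)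
      (fun i => sub_nonneg.2 (ha (Fin.le_last _)))
      (fun k hk => by
        have h := hx k (by omega)
        rw [Fin.sum_univ_castSucc] at h
        simpa [not_lt.2 hk] using h)
    have htotal : 0 ≤ ∑ i, x i := by simpa only [Fin.is_lt, if_true] using hx (n + 1) le_rfl
    have hlast := mul_nonneg (ha0 (Fin.last n)) htotal
    rw [Fin.sum_univ_castSucc] at hlast ⊢
    simp only [sub_mul, Finset.sum_sub_distrib, ← Finset.mul_sum] at hprefix
    linarith

/-- Rearrangement inequality for a matrix with unit row sums and column sums at most one. -/
theorem sum_mul_le_of_row_sum_eq_one_of_col_sum_le_one {N n : ℕ} (hnN : n ≤ N)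
    (P : Fin n → Fin N → ℝ) (hP : ∀ i j, 0 ≤ P i j) (hrow : ∀ i, ∑ j, P i j = 1)
    (hcol : ∀ j, ∑ i, P i j ≤ 1) (a : Fin n → ℝ) (b : Fin N → ℝ) (ha : Antitone a)
    (ha0 : ∀ i, 0 ≤ a i) (hb : Antitone b) :
    ∑ i, ∑ j, a i * b j * P i j ≤ ∑ i, a i * b (Fin.castLE hnN i) := by
  have key := sum_mul_nonneg_of_antitone_of_prefix a
    (fun i => b (Fin.castLE hnN i) - ∑ j, b j * P i j) ha ha0 ?_
  · simp only [mul_sub, Finset.sum_sub_distrib, Finset.mul_sum, ← mul_assoc] at key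
    linarith
  intro k hk
  rcases Nat.eq_zero_or_pos k with rfl | hk0
  · simp
  set c : Fin N → ℝ := fun j => ∑ i : Fin n, if i.val < k then P i j else 0 with hc
  have hc0 : ∀ j, 0 ≤ c j := fun j =>
    Finset.sum_nonneg fun i _ => by split_ifs <;> simp [hP]
  have hc1 : ∀ j, c j ≤ 1 := fun j =>
    (Finset.sum_le_sum fun i _ => by split_ifs <;> simp [hP]).trans (hcol j)
  have hextend : ∀ f : Fin N → ℝ, (∑ i : Fin n, if i.val < k then f (Fin.castLE hnN i) else 0) =
      ∑ j : Fin N, if j.val < k then f j else 0 := by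
    intro f
    rw [← Finset.sum_filter, ← Finset.sum_filter]
    refine Finset.sum_nbij' (fun i => Fin.castLE hnN i)
      (fun j => if h : j.val < n then ⟨j.val, h⟩ else ⟨0, by omega⟩) ?_ ?_ ?_ ?_ ?_
    · simp
    · intro j hj
      simp only [Finset.mem_filter, Finset.mem_univ, true_and] at hj ⊢
      simp [hj.trans_le hk, hj]
    · simp
    · intro j hj
      simp only [Finset.mem_filter, Finset.mem_univ, true_and] at hj
      simp [hj.trans_le hk]
    · simp
  have hcsum : ∑ j, c j = ∑ j : Fin N, if j.val < k then (1 : ℝ) else 0 := by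
    rw [← hextend (fun _ => 1), hc, Finset.sum_comm]
    refine Finset.sum_congr rfl fun i _ => ?_
    split_ifs <;> simp [hrow]
  have hbc : (∑ i : Fin n, if i.val < k then ∑ j, b j * P i j else 0) = ∑ j, b j * c j := by
    simp only [hc, Finset.mul_sum]
    rw [Finset.sum_comm]
    refine Finset.sum_congr rfl fun i _ => ?_
    split_ifs <;> simp
  have hsplit : (∑ i : Fin n,
      if i.val < k then b (Fin.castLE hnN i) - ∑ j, b j * P i j else 0) =
      ∑ j : Fin N, b j * ((if j.val < k then 1 else 0) - c j) := by
    simp only [mul_sub, Finset.sum_sub_distrib, ← hbc, mul_ite, mul_one, mul_zero, ← hextend b]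
    rw [← Finset.sum_sub_distrib]
    refine Finset.sum_congr rfl fun i _ => ?_
    split_ifs <;> simp
  rw [hsplit]
  set t : Fin N := ⟨k - 1, by omega⟩ with ht
  have hshift : ∑ j : Fin N, b j * ((if j.val < k then 1 else 0) - c j) =
      ∑ j : Fin N, (b j - b t) * ((if j.val < k then 1 else 0) - c j) := by
    simp only [sub_mul, Finset.sum_sub_distrib, ← Finset.mul_sum, hcsum, sub_self, mul_zero,
      sub_zero]
  rw [hshift]
  refine Finset.sum_nonneg fun j _ => ?_
  split_ifs with hj
  · refine mul_nonneg (sub_nonneg.2 (hb ?_)) (sub_nonneg.2 (hc1 j))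
    simp only [ht, Fin.le_def]
    omega
  · refine mul_nonneg_of_nonpos_of_nonpos (sub_nonpos.2 (hb ?_)) (by linarith [hc0 j])
    simp only [ht, Fin.le_def]
    omega

theorem Matrix.trace_diagonal_mul_mul_diagonal_mul_transpose {m k : Type*} [Fintype m]
    [Fintype k] [DecidableEq m] [DecidableEq k] (a : m → ℝ) (b : k → ℝ) (G : Matrix m k ℝ) :
    (diagonal a * (G * diagonal b * Gᵀ)).trace = ∑ i, ∑ j, a i * b j * G i j ^ 2 := by
  simp only [trace, diag_apply, diagonal_mul]
  refine Finset.sum_congr rfl fun i _ => ?_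
  rw [mul_apply, Finset.mul_sum]
  refine Finset.sum_congr rfl fun j _ => ?_
  rw [mul_diagonal, transpose_apply]
  ring

theorem Matrix.sum_sq_row_eq_one {m k : Type*} [Fintype k] [DecidableEq m]
    {G : Matrix m k ℝ} (hG : G * Gᵀ = 1) (i : m) : ∑ j, G i j ^ 2 = 1 := by
  have h := congrFun (congrFun hG i) i
  simpa [mul_apply, sq] using h

theorem Matrix.sum_sq_col_le_one {m k : Type*} [Fintype m] [Fintype k] [DecidableEq m]
    {G : Matrix m k ℝ} (hG : G * Gᵀ = 1) (j : k) : ∑ i, G i j ^ 2 ≤ 1 := by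
  set E := Gᵀ * G with hE
  have hidem : E * Eᵀ = E := by
    rw [hE, transpose_mul, transpose_transpose, Matrix.mul_assoc, ← Matrix.mul_assoc G, hG,
      Matrix.one_mul]
  have hdiag : ∑ i, G i j ^ 2 = E j j := by simp [hE, mul_apply, sq]
  have hsum : ∑ l, E j l ^ 2 = E j j := by
    conv_rhs => rw [← hidem]
    simp [mul_apply, sq]
  have hle : E j j ^ 2 ≤ ∑ l, E j l ^ 2 :=
    Finset.single_le_sum (f := fun l => E j l ^ 2) (fun l _ => sq_nonneg _) (Finset.mem_univ j)
  rw [hdiag]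
  nlinarith

/-- Von Neumann trace inequality for a compression by a matrix with orthonormal rows. -/
theorem Matrix.trace_diagonal_mul_compression_le {N n : ℕ} (hnN : n ≤ N)
    {G : Matrix (Fin n) (Fin N) ℝ} (hG : G * Gᵀ = 1) {a : Fin n → ℝ} {b : Fin N → ℝ}
    (ha : Antitone a) (ha0 : ∀ i, 0 ≤ a i) (hb : Antitone b) :
    (diagonal a * (G * diagonal b * Gᵀ)).trace ≤ ∑ i, a i * b (Fin.castLE hnN i) := by
  rw [trace_diagonal_mul_mul_diagonal_mul_transpose]
  exact sum_mul_le_of_row_sum_eq_one_of_col_sum_le_one hnN (fun i j => G i j ^ 2)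
    (fun _ _ => sq_nonneg _) (sum_sq_row_eq_one hG) (sum_sq_col_le_one hG) a b ha ha0 hb

theorem Matrix.le_trace_diagonal_mul_compression {N n : ℕ} (hnN : n ≤ N)
    {G : Matrix (Fin n) (Fin N) ℝ} (hG : G * Gᵀ = 1) {a : Fin n → ℝ} {b : Fin N → ℝ}
    (ha : Antitone a) (ha0 : ∀ i, 0 ≤ a i) (hb : Antitone b) :
    ∑ i, a i * b (Fin.castLE hnN i).rev ≤ (diagonal a * (G * diagonal b * Gᵀ)).trace := by
  rw [trace_diagonal_mul_mul_diagonal_mul_transpose]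
  have h := sum_mul_le_of_row_sum_eq_one_of_col_sum_le_one hnN (fun i j => G i j.rev ^ 2)
    (fun _ _ => sq_nonneg _)
    (fun i => (Equiv.sum_comp Fin.revPerm fun j => G i j ^ 2).trans (sum_sq_row_eq_one hG i))
    (fun j => sum_sq_col_le_one hG j.rev) a (fun j => -b j.rev) ha ha0
    (fun i j hij => neg_le_neg (hb (Fin.rev_le_rev.2 hij)))
  have hrev : ∀ i, ∑ j : Fin N, a i * -b j.rev * G i j.rev ^ 2 =
      -∑ j, a i * b j * G i j ^ 2 := fun i => by
    rw [← Finset.sum_neg_distrib]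
    simpa using Equiv.sum_comp Fin.revPerm fun j => -(a i * b j * G i j ^ 2)
  simp only [hrev] at h
  simp only [mul_neg, Finset.sum_neg_distrib] at h
  linarith

theorem Matrix.IsHermitian.exists_orthogonal_diagonalization {m : Type*} [Fintype m]
    [DecidableEq m] {A : Matrix m m ℝ} (hA : A.IsHermitian) (σ : Equiv.Perm m) :
    ∃ W : Matrix m m ℝ, W * Wᵀ = 1 ∧ Wᵀ * W = 1 ∧
      A = W * diagonal (hA.eigenvalues ∘ σ) * Wᵀ := by
  set Q : Matrix m m ℝ := hA.eigenvectorUnitary.1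
  have hQQ : Q * Qᵀ = 1 := by
    simpa [star_eq_conjTranspose] using Unitary.coe_mul_star_self hA.eigenvectorUnitary
  have hWW : Q.submatrix id σ * (Q.submatrix id σ)ᵀ = 1 := by
    rw [transpose_submatrix, submatrix_mul_equiv, hQQ]
    simp
  refine ⟨Q.submatrix id σ, hWW, mul_eq_one_comm.1 hWW, ?_⟩
  have hspec : A = Q * diagonal hA.eigenvalues * Qᵀ := by
    have h := hA.spectral_theorem
    rw [Unitary.conjStarAlgAut_apply] at h
    simpa [star_eq_conjTranspose, Function.comp_def] using h
  rw [← submatrix_diagonal_equiv, transpose_submatrix, submatrix_mul_equiv, submatrix_mul_equiv,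
    ← hspec, submatrix_id_id]

/-- Bound on `tr(UV) − tr((CUCᵀ)(CVCᵀ))` via sorted eigenvalues. -/
theorem stmt5 {N n : ℕ} (hn : 0 < n) (hnN : n ≤ N)
    (U V : Matrix (Fin N) (Fin N) ℝ) (hU : U.PosSemidef) (hV : V.PosSemidef)
    (C : Matrix (Fin n) (Fin N) ℝ) (hC : C * Cᵀ = 1)
    (hB : (C * U * Cᵀ).IsHermitian)
    (lam nu : Fin N → ℝ) (lamc : Fin n → ℝ)
    (hlam_mono : Antitone lam) (hnu_mono : Antitone nu) (hlamc_mono : Antitone lamc)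
    (hlam : ∃ σ : Equiv.Perm (Fin N), lam = hU.isHermitian.eigenvalues ∘ σ)
    (hnu : ∃ σ : Equiv.Perm (Fin N), nu = hV.isHermitian.eigenvalues ∘ σ)
    (hlamc : ∃ σ : Equiv.Perm (Fin n), lamc = hB.eigenvalues ∘ σ) :
    (U * V).trace - ((C * U * Cᵀ) * (C * V * Cᵀ)).trace ≤
      nu ⟨N - n, by omega⟩ *
        (∑ i : Fin n, (lam ⟨i.val, by have := i.isLt; omega⟩ - lamc i)) +
      ((∑ i : Fin n, lam ⟨i.val, by have := i.isLt; omega⟩ *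
          (nu ⟨i.val, by have := i.isLt; omega⟩ -
            nu (Fin.rev ⟨i.val, by have := i.isLt; omega⟩))) +
        ∑ i : Fin N, if n ≤ i.val then lam i * nu i else 0) ∧
    0 ≤ (∑ i : Fin n, lam ⟨i.val, by have := i.isLt; omega⟩ *
          (nu ⟨i.val, by have := i.isLt; omega⟩ -
            nu (Fin.rev ⟨i.val, by have := i.isLt; omega⟩))) +
        ∑ i : Fin N, if n ≤ i.val then lam i * nu i else 0 := by
  obtain ⟨σ, hσ⟩ := hlam
  obtain ⟨τ, hτ⟩ := hnu
  obtain ⟨ρ, hρ⟩ := hlamc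
  have hlam0 : ∀ i, 0 ≤ lam i := fun i => by rw [hσ]; exact hU.eigenvalues_nonneg _
  have hnu0 : ∀ i, 0 ≤ nu i := fun i => by rw [hτ]; exact hV.eigenvalues_nonneg _
  have hBpsd : (C * U * Cᵀ).PosSemidef := by
    simpa using hU.mul_mul_conjTranspose_same C
  have hlamc0 : ∀ i, 0 ≤ lamc i := fun i => by rw [hρ]; exact hBpsd.eigenvalues_nonneg _
  obtain ⟨W, hW, hW', hUW⟩ := hU.isHermitian.exists_orthogonal_diagonalization σ
  obtain ⟨X, hX, -, hVX⟩ := hV.isHermitian.exists_orthogonal_diagonalization τ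
  obtain ⟨Z, -, hZ', hBZ⟩ := hB.exists_orthogonal_diagonalization ρ
  rw [← hσ] at hUW
  rw [← hτ] at hVX
  rw [← hρ] at hBZ
  have hcompress : ∀ Y : Matrix (Fin N) (Fin N) ℝ, Y * Yᵀ = 1 →
      (Zᵀ * C * Y) * (Zᵀ * C * Y)ᵀ = 1 := fun Y hY => by
    calc (Zᵀ * C * Y) * (Zᵀ * C * Y)ᵀ = Zᵀ * (C * (Y * Yᵀ) * Cᵀ) * Z := by
          simp only [transpose_mul, transpose_transpose, Matrix.mul_assoc]
      _ = 1 := by rw [hY, Matrix.mul_one, hC, Matrix.mul_one, hZ']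
  have hUV : (U * V).trace ≤ ∑ i, lam i * nu i := by
    have hG : (Wᵀ * X) * (Wᵀ * X)ᵀ = 1 := by
      calc (Wᵀ * X) * (Wᵀ * X)ᵀ = Wᵀ * (X * Xᵀ) * W := by
            simp only [transpose_mul, transpose_transpose, Matrix.mul_assoc]
        _ = 1 := by rw [hX, Matrix.mul_one, hW']
    have htr : (U * V).trace =
        (diagonal lam * ((Wᵀ * X) * diagonal nu * (Wᵀ * X)ᵀ)).trace := by
      conv_lhs => rw [hUW, hVX, Matrix.mul_assoc W, Matrix.mul_assoc W, trace_mul_comm]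
      simp only [transpose_mul, transpose_transpose, Matrix.mul_assoc]
    rw [htr]
    simpa using trace_diagonal_mul_compression_le le_rfl hG hlam_mono hlam0 hnu_mono
  have hBD : ∑ i, lamc i * nu (Fin.castLE hnN i).rev ≤
      ((C * U * Cᵀ) * (C * V * Cᵀ)).trace := by
    have htr : ((C * U * Cᵀ) * (C * V * Cᵀ)).trace =
        (diagonal lamc * ((Zᵀ * C * X) * diagonal nu * (Zᵀ * C * X)ᵀ)).trace := by
      conv_lhs => rw [hBZ, hVX, Matrix.mul_assoc Z, Matrix.mul_assoc Z, trace_mul_comm]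
      simp only [transpose_mul, transpose_transpose, Matrix.mul_assoc]
    rw [htr]
    exact le_trace_diagonal_mul_compression hnN (hcompress X hX) hlamc_mono hlamc0 hnu_mono
  set t : Fin N := ⟨N - n, by omega⟩ with ht
  set w : Fin n → ℝ := fun i => nu t - nu (Fin.castLE hnN i).rev with hw
  have hw_mono : Antitone w := fun i j hij =>
    sub_le_sub_left (hnu_mono (Fin.rev_le_rev.2 hij)) _
  have hw0 : ∀ i, 0 ≤ w i := fun i => sub_nonneg.2 <| hnu_mono <| by
    have := i.isLt
    simp only [ht, Fin.le_def, Fin.val_rev, Fin.val_castLE]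
    omega
  have hmaj : ∑ i, w i * lamc i ≤ ∑ i, w i * lam (Fin.castLE hnN i) := by
    have hdiag : diagonal lamc = (Zᵀ * C * W) * diagonal lam * (Zᵀ * C * W)ᵀ := by
      calc diagonal lamc = (Zᵀ * Z) * diagonal lamc * (Zᵀ * Z) := by
            rw [hZ', Matrix.one_mul, Matrix.mul_one]
        _ = Zᵀ * (Z * diagonal lamc * Zᵀ) * Z := by simp only [Matrix.mul_assoc]
        _ = Zᵀ * (C * (W * diagonal lam * Wᵀ) * Cᵀ) * Z := by rw [← hBZ, ← hUW]
        _ = _ := by simp only [transpose_mul, transpose_transpose, Matrix.mul_assoc]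
    have h := trace_diagonal_mul_compression_le hnN (hcompress W hW) hw_mono hw0 hlam_mono
    rw [← hdiag, diagonal_mul_diagonal, trace_diagonal] at h
    exact h
  have hrearr : ∑ i, lam (Fin.castLE hnN i) * nu (Fin.castLE hnN i).rev ≤
      ∑ i, lam (Fin.castLE hnN i) * nu (Fin.castLE hnN i) := by
    have hG : (1 : Matrix (Fin N) (Fin N) ℝ).submatrix (Fin.castLE hnN) id *
        ((1 : Matrix (Fin N) (Fin N) ℝ).submatrix (Fin.castLE hnN) id)ᵀ = 1 := by
      rw [transpose_submatrix, transpose_one, ← submatrix_mul _ _ _ _ _ Function.bijective_id,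
        Matrix.one_mul, submatrix_one _ (Fin.castLE_injective hnN)]
    have hmono : Antitone fun i => lam (Fin.castLE hnN i) := fun i j hij => hlam_mono hij
    exact (le_trace_diagonal_mul_compression hnN hG hmono (fun i => hlam0 _) hnu_mono).trans
      (trace_diagonal_mul_compression_le hnN hG hmono (fun i => hlam0 _) hnu_mono)
  have htail : 0 ≤ ∑ i : Fin N, if n ≤ i.val then lam i * nu i else 0 :=
    Finset.sum_nonneg fun i _ => by
      split_ifs
      exacts [mul_nonneg (hlam0 i) (hnu0 i), le_rfl]
  have hsplit : ∑ i, lam i * nu i = ∑ i, lam (Fin.castLE hnN i) * nu (Fin.castLE hnN i) +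
      ∑ i : Fin N, if n ≤ i.val then lam i * nu i else 0 := by
    obtain ⟨m, rfl⟩ := Nat.exists_eq_add_of_le hnN
    simp [Fin.sum_univ_add, Fin.castAdd, fun i : Fin n => not_le.2 i.isLt]
  change _ ≤ nu t * (∑ i, (lam (Fin.castLE hnN i) - lamc i)) +
      (∑ i, lam (Fin.castLE hnN i) * (nu (Fin.castLE hnN i) - nu (Fin.castLE hnN i).rev) + _) ∧
    0 ≤ ∑ i, lam (Fin.castLE hnN i) * (nu (Fin.castLE hnN i) - nu (Fin.castLE hnN i).rev) + _
  simp only [hw, sub_mul, Finset.sum_sub_distrib, ← Finset.mul_sum] at hmaj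
  simp only [mul_sub, Finset.sum_sub_distrib]
  simp only [mul_comm (nu (Fin.rev _))] at hmaj
  constructor <;> linarith
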